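/- If P ⊆ B(n) is a maximal intersecting family, then {ID(p) : p ∈ min(P)} = min({ID(p) : p ∈ P}), where on the right min denotes the set of inclusion-minimal members of the set system {ID(p) : p ∈ P}. -/

import Mathlib

/-- The inversion set of a permutation `p` of `{0,…,n-1}` (0-indexed version of
`Inv(p) = {(p_j, p_i) : i < j, p_j < p_i}`): pairs `(a, b)` of values with `a < b`
such that `b` precedes `a` in the one-line notation of `p`. -/
def InvSet (n : ℕ) (p : Equiv.Perm (Fin n)) : Finset (Fin n × Fin n) :=
  Finset.univ.filter (fun x => x.1 < x.2 ∧ p.symm x.2 < p.symm x.1)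

/-- The weak (right) Bruhat order: `p ≼ q` iff `Inv(p) ⊆ Inv(q)`. -/
def BLE {n : ℕ} (p q : Equiv.Perm (Fin n)) : Prop :=
  InvSet n p ⊆ InvSet n q

/-- The rank of a permutation in the weak Bruhat order: `rank(p) = |Inv(p)|`. -/
def brank (n : ℕ) (p : Equiv.Perm (Fin n)) : ℕ :=
  (InvSet n p).card

/-- The inverse descent set `ID(p) ⊆ {1,…,n-1}`: `i ∈ ID(p)` iff the (1-indexed)
value `i+1` precedes the value `i` in the one-line notation of `p`.  Here the
1-indexed value `v ∈ {1,…,n}` corresponds to the element of `Fin n` with `val = v - 1`. -/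
def ID (n : ℕ) (p : Equiv.Perm (Fin n)) : Finset ℕ :=
  (Finset.Icc 1 (n - 1)).filter
    (fun i => ∃ a b : Fin n, (a : ℕ) + 1 = i ∧ (b : ℕ) = i ∧ p.symm b < p.symm a)

/-- The generator `g i` is the adjacent transposition interchanging the
(1-indexed) values `i` and `i+1`. -/
def g (n i : ℕ) : Equiv.Perm (Fin n) :=
  if h : 1 ≤ i ∧ i < n then Equiv.swap ⟨i - 1, by omega⟩ ⟨i, h.2⟩ else 1

/-- A family of permutations is intersecting if any two of its members have
meet different from the identity in the weak Bruhat lattice; equivalently (since the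
identity is the minimum), any two members have a common lower bound distinct
from the identity. -/
def BInter (n : ℕ) (P : Set (Equiv.Perm (Fin n))) : Prop :=
  ∀ p ∈ P, ∀ q ∈ P, ∃ r : Equiv.Perm (Fin n), r ≠ 1 ∧ BLE r p ∧ BLE r q

/-- A maximal intersecting family: intersecting, and every permutation
intersecting all its members belongs to it. -/
def MaxBInter (n : ℕ) (P : Set (Equiv.Perm (Fin n))) : Prop :=
  BInter n P ∧ ∀ q : Equiv.Perm (Fin n),
    (∀ p ∈ P, ∃ r : Equiv.Perm (Fin n), r ≠ 1 ∧ BLE r q ∧ BLE r p) → q ∈ P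

/-- The set of `≼`-minimal elements of a family `P`. -/
def minSet (n : ℕ) (P : Set (Equiv.Perm (Fin n))) : Set (Equiv.Perm (Fin n)) :=
  {p | p ∈ P ∧ ∀ q ∈ P, BLE q p → q = p}

/-- `m` is the meet (greatest lower bound) of `p` and `q` in the weak Bruhat order. -/
def IsMeetB (n : ℕ) (p q m : Equiv.Perm (Fin n)) : Prop :=
  BLE m p ∧ BLE m q ∧ ∀ r, BLE r p → BLE r q → BLE r m

/-- `m` is the join (least upper bound) of the set `S` in the weak Bruhat order. -/
def IsLUBB (n : ℕ) (S : Set (Equiv.Perm (Fin n))) (m : Equiv.Perm (Fin n)) : Prop :=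
  (∀ s ∈ S, BLE s m) ∧ ∀ u, (∀ s ∈ S, BLE s u) → BLE m u

/-- For a system `𝒜` of subsets of `{1,…,n-1}`,
`P(𝒜) = {p : A ⊆ ID(p) for some A ∈ 𝒜}`. -/
def PofSystem (n : ℕ) (𝒜 : Set (Finset ℕ)) : Set (Equiv.Perm (Fin n)) :=
  {p | ∃ A ∈ 𝒜, A ⊆ ID n p}

/-- The generating set system of a family `P`: `{ID(p) : p ∈ min(P)}`. -/
def genSys (n : ℕ) (P : Set (Equiv.Perm (Fin n))) : Set (Finset ℕ) :=
  {A | ∃ p ∈ minSet n P, ID n p = A}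

/-- A maximal intersecting antichain of subsets of `{1,…,n-1}`: an antichain
under inclusion, any two members of which meet, such that for every subset `B`
of `{1,…,n-1}` not in the system there is a member `A` with `A ∩ B = ∅` or `A ⊆ B`. -/
def MIA (n : ℕ) (𝒜 : Set (Finset ℕ)) : Prop :=
  (∀ A ∈ 𝒜, ∀ B ∈ 𝒜, A ⊆ B → A = B) ∧
  (∀ A ∈ 𝒜, ∀ B ∈ 𝒜, (A ∩ B).Nonempty) ∧
  (∀ B : Finset ℕ, B ⊆ Finset.Icc 1 (n - 1) → B ∉ 𝒜 → ∃ A ∈ 𝒜, A ∩ B = ∅ ∨ A ⊆ B)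

theorem mem_ID_iff {n i : ℕ} {p : Equiv.Perm (Fin n)} :
    i ∈ ID n p ↔ ∃ a b : Fin n, (a : ℕ) + 1 = i ∧ (b : ℕ) = i ∧ p.symm b < p.symm a := by
  simp only [ID, Finset.mem_filter, Finset.mem_Icc, and_iff_right_iff_imp]
  rintro ⟨a, b, ha, hb, -⟩
  omega

theorem mem_InvSet_iff {n : ℕ} {p : Equiv.Perm (Fin n)} {a b : Fin n} :
    (a, b) ∈ InvSet n p ↔ a < b ∧ p.symm b < p.symm a := by
  simp [InvSet]

theorem BLE.ID_subset {n : ℕ} {p q : Equiv.Perm (Fin n)} (h : BLE p q) : ID n p ⊆ ID n q := by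
  intro i hi
  obtain ⟨a, b, ha, hb, hab⟩ := mem_ID_iff.1 hi
  have hlt : a < b := Fin.lt_def.2 (by omega)
  exact mem_ID_iff.2 ⟨a, b, ha, hb, (mem_InvSet_iff.1 (h (mem_InvSet_iff.2 ⟨hlt, hab⟩))).2⟩

theorem perm_eq_one_of_strictMono {n : ℕ} {p : Equiv.Perm (Fin n)} (h : StrictMono p) :
    p = 1 :=
  Equiv.ext fun a => by
    have := Subsingleton.elim (h.orderIsoOfSurjective p p.surjective) (OrderIso.refl (Fin n))
    exact DFunLike.congr_fun this a

theorem BLE.antisymm {n : ℕ} {p q : Equiv.Perm (Fin n)} (hpq : BLE p q) (hqp : BLE q p) :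
    p = q := by
  have key : ∀ a b, p.symm a < p.symm b → q.symm a < q.symm b := by
    intro a b hab
    rcases lt_trichotomy a b with h | rfl | h
    · by_contra hn
      have hne : q.symm a ≠ q.symm b := q.symm.injective.ne h.ne
      have := (mem_InvSet_iff.1 (hqp (mem_InvSet_iff.2 ⟨h, lt_of_le_of_ne (not_lt.1 hn) hne.symm⟩))).2
      exact absurd hab this.asymm
    · exact absurd hab (lt_irrefl _)
    · exact (mem_InvSet_iff.1 (hpq (mem_InvSet_iff.2 ⟨h, hab⟩))).2
  have hmono : StrictMono (q⁻¹ * p : Equiv.Perm (Fin n)) := fun a b hab =>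
    key (p a) (p b) (by simpa using hab)
  have hone : (q⁻¹ * p : Equiv.Perm (Fin n)) = 1 := perm_eq_one_of_strictMono hmono
  exact (inv_mul_eq_one.1 hone).symm

theorem ID_one (n : ℕ) : ID n 1 = ∅ := by
  refine Finset.eq_empty_of_forall_notMem fun i hi => ?_
  obtain ⟨a, b, ha, hb, hab⟩ := mem_ID_iff.1 hi
  have : (b : ℕ) < a := hab
  omega

theorem symm_lt_symm_of_Icc_subset_ID {n : ℕ} {p : Equiv.Perm (Fin n)} {a b : Fin n} (hab : a < b)
    (h : Finset.Icc ((a : ℕ) + 1) b ⊆ ID n p) : p.symm b < p.symm a := by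
  obtain ⟨b, hb⟩ := b
  induction b with
  | zero => exact absurd (Fin.lt_def.1 hab) (Nat.not_lt_zero _)
  | succ b ih =>
    have hab' : (a : ℕ) < b + 1 := hab
    obtain ⟨c, d, hc, hd, hcd⟩ := mem_ID_iff.1 (h (Finset.mem_Icc.2 ⟨hab', le_rfl⟩))
    obtain rfl : d = ⟨b + 1, hb⟩ := Fin.ext hd
    have hbn : b < n := by omega
    obtain rfl : c = ⟨b, hbn⟩ := Fin.ext (Nat.succ_injective hc)
    rcases (Nat.lt_succ_iff.1 hab').lt_or_eq with hlt | heq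
    · exact hcd.trans (ih hbn hlt
        ((Finset.Icc_subset_Icc_right (Nat.le_succ b)).trans h))
    · obtain rfl : a = ⟨b, hbn⟩ := Fin.ext heq
      exact hcd

theorem ID_nonempty {n : ℕ} {p : Equiv.Perm (Fin n)} (hp : p ≠ 1) : (ID n p).Nonempty := by
  by_contra hne
  rw [Finset.not_nonempty_iff_eq_empty] at hne
  refine hp (inv_eq_one.1 (perm_eq_one_of_strictMono ?_))
  cases n with
  | zero => exact fun a => a.elim0
  | succ m =>
    refine Fin.strictMono_iff_lt_succ.2 fun i => ?_
    by_contra hlt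
    have hne' : p.symm i.succ ≠ p.symm i.castSucc :=
      p.symm.injective.ne (Fin.castSucc_lt_succ (i := i)).ne'
    have : (i : ℕ) + 1 ∈ ID (m + 1) p :=
      mem_ID_iff.2 ⟨i.castSucc, i.succ, by simp, by simp, lt_of_le_of_ne (not_lt.1 hlt) hne'⟩
    simp [hne] at this

/-- The sorting key of the value `v` in `blockReversal n A`: first the block containing `v`
(blocks being separated by the `i ∉ A`), then `v` itself in decreasing order. -/
def blockKey (n : ℕ) (A : Finset ℕ) (v : Fin n) : ℕ ×ₗ (Fin n)ᵒᵈ :=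
  toLex ((Finset.Icc 1 (v : ℕ) \ A).card, OrderDual.toDual v)

/-- The permutation reversing each maximal run of values linked by `A`: the longest element of
the parabolic subgroup generated by the `g n i`, `i ∈ A`. -/
def blockReversal (n : ℕ) (A : Finset ℕ) : Equiv.Perm (Fin n) :=
  Tuple.sort (blockKey n A)

theorem blockReversal_symm_lt_iff {n : ℕ} {A : Finset ℕ} {a b : Fin n} :
    (blockReversal n A).symm b < (blockReversal n A).symm a ↔ blockKey n A b < blockKey n A a := by
  have hinj : Function.Injective (blockKey n A) := fun a b h =>
    congrArg (fun x : ℕ ×ₗ (Fin n)ᵒᵈ => OrderDual.ofDual (ofLex x).2) h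
  have hmono : StrictMono (blockKey n A ∘ blockReversal n A) :=
    (Tuple.monotone_sort _).strictMono_of_injective
      (hinj.comp (blockReversal n A).injective)
  simpa using (hmono.lt_iff_lt (a := (blockReversal n A).symm b)
    (b := (blockReversal n A).symm a)).symm

theorem blockReversal_symm_lt_iff_of_lt {n : ℕ} {A : Finset ℕ} {a b : Fin n} (hab : a < b) :
    (blockReversal n A).symm b < (blockReversal n A).symm a ↔
      Finset.Icc ((a : ℕ) + 1) b ⊆ A := by
  have hab' : (a : ℕ) < b := hab
  have hsub : Finset.Icc 1 (a : ℕ) \ A ⊆ Finset.Icc 1 (b : ℕ) \ A :=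
    Finset.sdiff_subset_sdiff (Finset.Icc_subset_Icc_right hab'.le) subset_rfl
  rw [blockReversal_symm_lt_iff, blockKey, blockKey, Prod.Lex.toLex_lt_toLex]
  simp only [OrderDual.toDual_lt_toDual, hab, and_true, ← le_iff_lt_or_eq]
  constructor
  · intro hcard i hi
    have heq := Finset.eq_of_subset_of_card_le hsub hcard
    rw [Finset.mem_Icc] at hi
    by_contra hiA
    have : i ∈ Finset.Icc 1 (a : ℕ) \ A := by
      rw [heq, Finset.mem_sdiff, Finset.mem_Icc]
      exact ⟨⟨by omega, hi.2⟩, hiA⟩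
    rw [Finset.mem_sdiff, Finset.mem_Icc] at this
    omega
  · intro h
    refine Finset.card_le_card fun i hi => ?_
    rw [Finset.mem_sdiff, Finset.mem_Icc] at hi ⊢
    refine ⟨⟨hi.1.1, ?_⟩, hi.2⟩
    by_contra hai
    exact hi.2 (h (Finset.mem_Icc.2 ⟨by omega, hi.1.2⟩))

theorem blockReversal_ID_subset (n : ℕ) (A : Finset ℕ) : ID n (blockReversal n A) ⊆ A := by
  intro i hi
  obtain ⟨a, b, ha, hb, hlt⟩ := mem_ID_iff.1 hi
  exact (blockReversal_symm_lt_iff_of_lt (Fin.lt_def.2 (by omega))).1 hlt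
    (Finset.mem_Icc.2 ⟨ha.le, hb.ge⟩)

theorem subset_ID_blockReversal {n : ℕ} {A : Finset ℕ} {p : Equiv.Perm (Fin n)}
    (h : A ⊆ ID n p) : A ⊆ ID n (blockReversal n A) := by
  intro i hi
  obtain ⟨a, b, ha, hb, -⟩ := mem_ID_iff.1 (h hi)
  refine mem_ID_iff.2 ⟨a, b, ha, hb,
    (blockReversal_symm_lt_iff_of_lt (Fin.lt_def.2 (by omega))).2 fun j hj => ?_⟩
  rw [Finset.mem_Icc] at hj
  obtain rfl : j = i := by omega
  exact hi

theorem ID_blockReversal {n : ℕ} {A : Finset ℕ} {p : Equiv.Perm (Fin n)}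
    (h : A ⊆ ID n p) : ID n (blockReversal n A) = A :=
  (blockReversal_ID_subset n A).antisymm (subset_ID_blockReversal h)

theorem blockReversal_BLE {n : ℕ} {A : Finset ℕ} {p : Equiv.Perm (Fin n)}
    (h : A ⊆ ID n p) : BLE (blockReversal n A) p := by
  rintro ⟨a, b⟩ hx
  obtain ⟨hab, hlt⟩ := mem_InvSet_iff.1 hx
  exact mem_InvSet_iff.2 ⟨hab, symm_lt_symm_of_Icc_subset_ID hab
    (((blockReversal_symm_lt_iff_of_lt hab).1 hlt).trans h)⟩

theorem exists_common_lower_bound_iff {n : ℕ} {p q : Equiv.Perm (Fin n)} :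
    (∃ r : Equiv.Perm (Fin n), r ≠ 1 ∧ BLE r p ∧ BLE r q) ↔ (ID n p ∩ ID n q).Nonempty := by
  constructor
  · rintro ⟨r, hr, hrp, hrq⟩
    exact (ID_nonempty hr).mono (Finset.subset_inter hrp.ID_subset hrq.ID_subset)
  · rintro ⟨i, hi⟩
    rw [Finset.mem_inter] at hi
    have hp := Finset.singleton_subset_iff.2 hi.1
    have hq := Finset.singleton_subset_iff.2 hi.2
    refine ⟨blockReversal n {i}, fun h1 => ?_, blockReversal_BLE hp, blockReversal_BLE hq⟩
    have hID := ID_blockReversal hp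
    rw [h1, ID_one] at hID
    exact Finset.singleton_ne_empty i hID.symm

theorem MaxBInter.mem_of_ID_subset {n : ℕ} {P : Set (Equiv.Perm (Fin n))} (hP : MaxBInter n P)
    {p q : Equiv.Perm (Fin n)} (hp : p ∈ P) (h : ID n p ⊆ ID n q) : q ∈ P :=
  hP.2 q fun r hr => exists_common_lower_bound_iff.2
    ((exists_common_lower_bound_iff.1 (hP.1 p hp r hr)).mono
      (Finset.inter_subset_inter_right h))

theorem MaxBInter.blockReversal_mem {n : ℕ} {P : Set (Equiv.Perm (Fin n))} (hP : MaxBInter n P)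
    {p : Equiv.Perm (Fin n)} (hp : p ∈ P) : blockReversal n (ID n p) ∈ P :=
  hP.mem_of_ID_subset hp (subset_ID_blockReversal subset_rfl)

/-- If `P ⊆ B(n)` is a maximal intersecting family, then
`{ID(p) : p ∈ min(P)}` equals the set of inclusion-minimal members of
`{ID(p) : p ∈ P}`. -/
theorem stmt_11 (n : ℕ) (P : Set (Equiv.Perm (Fin n))) (hP : MaxBInter n P) :
    genSys n P =
      {A | (∃ p ∈ P, ID n p = A) ∧
        ∀ B : Finset ℕ, (∃ p ∈ P, ID n p = B) → B ⊆ A → B = A} := by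
  ext A
  constructor
  · rintro ⟨p, ⟨hpP, hmin⟩, rfl⟩
    refine ⟨⟨p, hpP, rfl⟩, ?_⟩
    rintro _ ⟨q, hqP, rfl⟩ hqp
    rw [← hmin _ (hP.blockReversal_mem hqP) (blockReversal_BLE hqp), ID_blockReversal hqp]
  · rintro ⟨⟨p, hpP, rfl⟩, hmin⟩
    have hID : ID n (blockReversal n (ID n p)) = ID n p := ID_blockReversal subset_rfl
    refine ⟨blockReversal n (ID n p), ⟨hP.blockReversal_mem hpP, fun q hqP hq => ?_⟩, hID⟩
    have hqID : ID n q = ID n p := hmin _ ⟨q, hqP, rfl⟩ (hq.ID_subset.trans_eq hID)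
    exact hq.antisymm (blockReversal_BLE hqID.ge)
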